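/- Let ψ : ℕ → (0,∞) be an approximating function. If the series Σ_{h=2}^∞ ψ(h) log h converges, then ℋ¹(C_f ∩ S₂*(ψ)) = 0; in particular the set of x ∈ I with (x, f(x)) ∈ S₂*(ψ) has Lebesgue measure zero. -/

import Mathlib

open MeasureTheory Filter

/-- Distance from `x` to the nearest integer, `‖x‖ = min_{z ∈ ℤ} |x - z|`. -/
noncomputable def nint (x : ℝ) : ℝ := ⨅ z : ℤ, |x - (z : ℝ)|

/-- `S₂*(ψ)`: points `(x, y) ∈ ℝ²` with `‖qx‖ ⬝ ‖qy‖ < ψ(q)` for infinitely many `q ∈ ℕ`. -/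
def S2star (ψ : ℕ → ℝ) : Set (EuclideanSpace ℝ (Fin 2)) :=
  { p | {q : ℕ | 0 < q ∧ nint (q * p 0) * nint (q * p 1) < ψ q}.Infinite }

/-- The half-open unit cube. -/
def unitCube (ι : Type*) : Set (ι → ℝ) := Set.univ.pi fun _ => Set.Ico 0 1

/-- The exponential sum with integer frequencies in `S`. -/
noncomputable def expSum {ι : Type*} [Fintype ι] (S : Finset (ι → ℤ)) (t : ι → ℝ) : ℂ :=
  ∑ z ∈ S, Complex.exp (2 * Real.pi * Complex.I * ((∑ i, (z i : ℝ) * t i : ℝ) : ℂ))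

theorem measurableSet_unitCube (ι : Type*) [Countable ι] : MeasurableSet (unitCube ι) :=
  MeasurableSet.univ_pi fun _ => measurableSet_Ico

theorem continuous_expSum {ι : Type*} [Fintype ι] (S : Finset (ι → ℤ)) :
    Continuous (expSum S) := by
  unfold expSum
  fun_prop

theorem Continuous.integrableOn_unitCube {ι E : Type*} [Fintype ι] [NormedAddCommGroup E]
    {g : (ι → ℝ) → E} (hg : Continuous g) : IntegrableOn g (unitCube ι) := by
  refine (hg.continuousOn.integrableOn_compact (isCompact_Icc (a := 0) (b := 1))).mono_set ?_
  intro t ht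
  exact ⟨fun i => (ht i trivial).1, fun i => (ht i trivial).2.le⟩

theorem setIntegral_unitCube_exp {ι : Type*} [Fintype ι] (k : ι → ℤ) :
    ∫ t in unitCube ι, Complex.exp (2 * Real.pi * Complex.I * ((∑ i, (k i : ℝ) * t i : ℝ) : ℂ)) =
      if k = 0 then 1 else 0 := by
  have one (m : ℤ) : ∫ s in Set.Ico (0 : ℝ) 1, Complex.exp (2 * Real.pi * Complex.I * m * s) =
      if m = 0 then 1 else 0 := by
    rw [integral_Ico_eq_integral_Ioc, ← intervalIntegral.integral_of_le zero_le_one]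
    split_ifs with hm
    · simp [hm]
    · have hc : (2 * Real.pi * Complex.I * m : ℂ) ≠ 0 := by
        simp [Real.pi_ne_zero, hm]
      rw [integral_exp_mul_complex hc]
      have : Complex.exp (2 * Real.pi * Complex.I * m * ((1 : ℝ) : ℂ)) = 1 := by
        rw [Complex.exp_eq_one_iff]
        exact ⟨m, by push_cast; ring⟩
      rw [this]
      simp
  have prod (t : ι → ℝ) :
      Complex.exp (2 * Real.pi * Complex.I * ((∑ i, (k i : ℝ) * t i : ℝ) : ℂ)) =
        ∏ i, Complex.exp (2 * Real.pi * Complex.I * (k i) * (t i)) := by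
    rw [← Complex.exp_sum]
    congr 1
    push_cast
    rw [Finset.mul_sum]
    exact Finset.sum_congr rfl fun i _ => by ring
  simp_rw [prod]
  rw [unitCube, volume_pi, Measure.restrict_pi_pi,
    integral_fintype_prod_eq_prod (f := fun i (s : ℝ) =>
      Complex.exp (2 * Real.pi * Complex.I * (k i) * s))]
  simp_rw [one]
  split_ifs with hk
  · simp [hk]
  · obtain ⟨i, hi⟩ := Function.ne_iff.mp hk
    exact Finset.prod_eq_zero (Finset.mem_univ i) (if_neg hi)

theorem setIntegral_unitCube_norm_expSum_sq {ι : Type*} [Fintype ι] (S : Finset (ι → ℤ)) :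
    ∫ t in unitCube ι, ‖expSum S t‖ ^ 2 = S.card := by
  have expand (t : ι → ℝ) : ((‖expSum S t‖ ^ 2 : ℝ) : ℂ) = ∑ z ∈ S, ∑ z' ∈ S,
      Complex.exp (2 * Real.pi * Complex.I * ((∑ i, (((z - z') i : ℤ) : ℝ) * t i : ℝ) : ℂ)) := by
    push_cast
    rw [← Complex.mul_conj', expSum, map_sum, Finset.sum_mul_sum]
    refine Finset.sum_congr rfl fun z _ => Finset.sum_congr rfl fun z' _ => ?_
    rw [← Complex.exp_conj, ← Complex.exp_add]
    congr 1
    simp only [map_mul, Complex.conj_ofReal, Complex.conj_I, map_ofNat]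
    simp only [Pi.sub_apply, Int.cast_sub, sub_mul, Finset.sum_sub_distrib]
    push_cast
    ring
  have key : ((∫ t in unitCube ι, ‖expSum S t‖ ^ 2 : ℝ) : ℂ) = S.card := by
    rw [← integral_complex_ofReal]
    simp_rw [expand]
    rw [integral_finsetSum _ fun z _ => ?_]
    · have inner (z : ι → ℤ) (hz : z ∈ S) : ∫ t in unitCube ι, ∑ z' ∈ S,
          Complex.exp (2 * Real.pi * Complex.I * ((∑ i, (((z - z') i : ℤ) : ℝ) * t i : ℝ) : ℂ)) =
            1 := by
        rw [integral_finsetSum _ fun z' _ => ?_]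
        · simp_rw [setIntegral_unitCube_exp, sub_eq_zero]
          simp [hz]
        · exact Continuous.integrableOn_unitCube (by fun_prop)
      rw [Finset.sum_congr rfl inner]
      simp
    · exact Continuous.integrableOn_unitCube (by fun_prop)
  exact_mod_cast key

theorem expSum_add_intCast {ι : Type*} [Fintype ι] (S : Finset (ι → ℤ)) (t : ι → ℝ)
    (n : ι → ℤ) : expSum S (t + fun i => (n i : ℝ)) = expSum S t := by
  refine Finset.sum_congr rfl fun z _ => ?_
  rw [Complex.exp_eq_exp_iff_exists_int]
  refine ⟨∑ i, z i * n i, ?_⟩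
  simp only [Pi.add_apply, mul_add, Finset.sum_add_distrib]
  push_cast
  ring

/-- A periodic function has at most as much mass on a set injecting into the torus as on the unit
cube. -/
theorem setLIntegral_le_setLIntegral_unitCube {ι : Type*} [Fintype ι] {B : Set (ι → ℝ)}
    (hB : MeasurableSet B)
    (hinj : ∀ a ∈ B, ∀ b ∈ B, ∀ n : ι → ℤ, (∀ i, a i - b i = n i) → n = 0)
    (g : (ι → ℝ) → ENNReal) (hper : ∀ t, ∀ n : ι → ℤ, g (t + fun i => (n i : ℝ)) = g t) :
    ∫⁻ t in B, g t ≤ ∫⁻ t in unitCube ι, g t := by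
  let v : (ι → ℤ) → ι → ℝ := fun n i => n i
  let D : (ι → ℤ) → Set (ι → ℝ) := fun n => {t | t + v n ∈ B ∧ t ∈ unitCube ι}
  have hD (n : ι → ℤ) : MeasurableSet (D n) :=
    ((measurable_add_const (v n)) hB).inter (measurableSet_unitCube ι)
  have hcover : B ⊆ ⋃ n : ι → ℤ, {t | t ∈ B ∧ t - v n ∈ unitCube ι} := by
    intro t ht
    refine Set.mem_iUnion.mpr ⟨fun i => ⌊t i⌋, ht, fun i _ => ?_⟩
    exact ⟨Int.fract_nonneg (t i), Int.fract_lt_one (t i)⟩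
  calc ∫⁻ t in B, g t ≤ ∫⁻ t in ⋃ n : ι → ℤ, {t | t ∈ B ∧ t - v n ∈ unitCube ι}, g t :=
        lintegral_mono_set hcover
    _ ≤ ∑' n : ι → ℤ, ∫⁻ t in {t | t ∈ B ∧ t - v n ∈ unitCube ι}, g t :=
        lintegral_iUnion_le _ _
    _ = ∑' n : ι → ℤ, ∫⁻ t in D n, g t := by
        congr 1
        funext n
        have hm : MeasurableSet {t | t ∈ B ∧ t - v n ∈ unitCube ι} :=
          hB.inter ((measurable_sub_const (v n)) (measurableSet_unitCube ι))
        rw [← lintegral_indicator hm, ← lintegral_indicator (hD n),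
          ← lintegral_add_right_eq_self _ (v n)]
        congr 1
        funext t
        by_cases h : t ∈ D n
        · rw [Set.indicator_of_mem h, Set.indicator_of_mem, hper]
          simpa [D] using h
        · rw [Set.indicator_of_notMem h, Set.indicator_of_notMem]
          simpa [D] using h
    _ = ∫⁻ t in ⋃ n, D n, g t := by
        rw [lintegral_iUnion hD]
        intro m n hmn
        refine Set.disjoint_left.mpr fun t hm hn => hmn ?_
        rw [← sub_eq_zero]
        refine hinj _ hm.1 _ hn.1 (m - n) fun i => ?_
        simp [v]
    _ ≤ ∫⁻ t in unitCube ι, g t :=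
        lintegral_mono_set (Set.iUnion_subset fun n t ht => ht.2)

theorem card_mul_volume_le {ι : Type*} [Fintype ι] {B : Set (ι → ℝ)}
    (hB : MeasurableSet B)
    (hinj : ∀ a ∈ B, ∀ b ∈ B, ∀ n : ι → ℤ, (∀ i, a i - b i = n i) → n = 0)
    (S : Finset (ι → ℤ)) (hS : ∀ z ∈ S, ∀ t ∈ B, |∑ i, (z i : ℝ) * t i| ≤ 1 / 8) :
    ENNReal.ofReal (S.card ^ 2 / 2) * volume B ≤ ENNReal.ofReal S.card := by
  have lower (t : ι → ℝ) (ht : t ∈ B) : (S.card : ℝ) ^ 2 / 2 ≤ ‖expSum S t‖ ^ 2 := by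
    have hre : (S.card : ℝ) * (√2 / 2) ≤ ‖expSum S t‖ := by
      refine le_trans ?_ (Complex.re_le_norm _)
      rw [expSum, Complex.re_sum, ← nsmul_eq_mul]
      refine Finset.card_nsmul_le_sum _ _ _ fun z hz => ?_
      set s : ℝ := ∑ i, (z i : ℝ) * t i with hs
      have h8 : |s| ≤ 1 / 8 := hS z hz t ht
      have : (2 * Real.pi * Complex.I * (s : ℂ)) = ((2 * Real.pi * s : ℝ) : ℂ) * Complex.I := by
        push_cast; ring
      rw [this, Complex.exp_ofReal_mul_I_re, ← Real.cos_abs, ← Real.cos_pi_div_four]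
      refine Real.cos_le_cos_of_nonneg_of_le_pi (abs_nonneg _) ?_ ?_
      · linarith [Real.pi_pos]
      · rw [abs_mul, abs_of_pos (by positivity)]
        nlinarith [Real.pi_pos]
    calc (S.card : ℝ) ^ 2 / 2 = ((S.card : ℝ) * (√2 / 2)) ^ 2 := by
          rw [mul_pow, div_pow, Real.sq_sqrt zero_le_two]; ring
      _ ≤ _ := by gcongr
  calc ENNReal.ofReal (S.card ^ 2 / 2) * volume B
      = ∫⁻ _ in B, ENNReal.ofReal (S.card ^ 2 / 2) := by simp
    _ ≤ ∫⁻ t in B, ENNReal.ofReal (‖expSum S t‖ ^ 2) :=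
        setLIntegral_mono' hB fun t ht => ENNReal.ofReal_le_ofReal (lower t ht)
    _ ≤ ∫⁻ t in unitCube ι, ENNReal.ofReal (‖expSum S t‖ ^ 2) :=
        setLIntegral_le_setLIntegral_unitCube hB hinj _ fun t n => by
          rw [expSum_add_intCast]
    _ = ENNReal.ofReal S.card := by
        have hsq : IntegrableOn (fun t => ‖expSum S t‖ ^ 2) (unitCube ι) :=
          ((continuous_expSum S).norm.pow 2).integrableOn_unitCube
        rw [← ofReal_integral_eq_lintegral_ofReal
          hsq
          (Eventually.of_forall fun t => by positivity), setIntegral_unitCube_norm_expSum_sq]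

/-- If the dual parallelepiped contains no nonzero integer vector, the number of integer vectors in
a parallelepiped is bounded by a multiple of its volume. -/
theorem card_le_of_dual_trivial {x y s A₁ A₂ A₃ : ℝ} (hA₁ : 0 < A₁) (hA₂ : 0 < A₂) (hA₃ : 0 < A₃)
    (S : Finset (Fin 3 → ℤ))
    (hS : ∀ z ∈ S, |(z 0 : ℝ)| ≤ A₁ ∧ |z 0 * x - z 1| ≤ A₂ ∧
      |z 0 * y - z 2 - s * (z 0 * x - z 1)| ≤ A₃)
    (hdual : ∀ n : Fin 3 → ℤ, |(n 2 : ℝ)| ≤ 1 / A₃ → |n 1 + n 2 * s| ≤ 1 / A₂ →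
      |n 0 + n 1 * x + n 2 * y| ≤ 1 / A₁ → n = 0) :
    (S.card : ℝ) ≤ 3456 * (A₁ * A₂ * A₃) := by
  let b : Fin 3 → ℝ := ![1 / (24 * A₁), 1 / (24 * A₂), 1 / (24 * A₃)]
  let T : Matrix (Fin 3) (Fin 3) ℝ := !![1, x, y; 0, 1, s; 0, 0, 1]
  let B : Set (Fin 3 → ℝ) := Matrix.toLin' T ⁻¹' Set.Icc (-b) b
  have hdet : LinearMap.det (Matrix.toLin' T) = 1 := by
    rw [LinearMap.det_toLin', Matrix.det_fin_three]
    simp [T]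
  have mem (t : Fin 3 → ℝ) : t ∈ B ↔ |t 0 + x * t 1 + y * t 2| ≤ 1 / (24 * A₁) ∧
      |t 1 + s * t 2| ≤ 1 / (24 * A₂) ∧ |t 2| ≤ 1 / (24 * A₃) := by
    simp only [B, T, b, Set.mem_preimage, Set.mem_Icc, Pi.le_def, Fin.forall_fin_succ, abs_le,
      Matrix.toLin'_apply, Matrix.mulVec, dotProduct, Fin.sum_univ_three]
    simp
    tauto
  have hvol : volume B = ENNReal.ofReal (1 / (1728 * (A₁ * A₂ * A₃))) := by
    rw [Measure.addHaar_preimage_linearMap _ (by rw [hdet]; exact one_ne_zero), hdet,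
      Real.volume_Icc_pi, Fin.prod_univ_three, ← ENNReal.ofReal_mul, ← ENNReal.ofReal_mul]
    · simp only [inv_one, abs_one, ENNReal.ofReal_one, one_mul, b, Pi.neg_apply]
      congr 1
      simp
      field_simp
      norm_num
    all_goals simp [b]; positivity
  have hB : MeasurableSet B :=
    measurableSet_Icc.preimage (LinearMap.continuous_of_finiteDimensional _).measurable
  have hinj : ∀ a ∈ B, ∀ c ∈ B, ∀ n : Fin 3 → ℤ, (∀ i, a i - c i = n i) → n = 0 := by
    intro a ha c hc n hn
    rw [mem] at ha hc
    obtain ⟨a0, a1, a2⟩ := ha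
    obtain ⟨b0, b1, b2⟩ := hc
    have sub {p q A : ℝ} (hA : 0 < A) (hp : |p| ≤ 1 / (24 * A)) (hq : |q| ≤ 1 / (24 * A)) :
        |p - q| ≤ 1 / A := by
      refine (abs_sub p q).trans ((add_le_add hp hq).trans ?_)
      have : 1 / (24 * A) + 1 / (24 * A) = 1 / A * (1 / 12) := by field_simp; norm_num
      rw [this]
      have : 0 < 1 / A := by positivity
      linarith
    refine hdual n ?_ ?_ ?_
    · rw [← hn]; exact sub hA₃ a2 b2
    · rw [← hn, ← hn]
      convert sub hA₂ a1 b1 using 2; ring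
    · rw [← hn, ← hn, ← hn]
      convert sub hA₁ a0 b0 using 2; ring
  have hsmall : ∀ z ∈ S, ∀ t ∈ B, |∑ i, (z i : ℝ) * t i| ≤ 1 / 8 := by
    intro z hz t ht
    rw [mem] at ht
    obtain ⟨t0, t1, t2⟩ := ht
    obtain ⟨z0, z1, z2⟩ := hS z hz
    have mul {p q A : ℝ} (hA : 0 < A) (hp : |p| ≤ A) (hq : |q| ≤ 1 / (24 * A)) :
        |p * q| ≤ 1 / 24 := by
      rw [abs_mul]
      calc |p| * |q| ≤ A * (1 / (24 * A)) := by gcongr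
        _ = 1 / 24 := by field_simp
    have e : ∑ i, (z i : ℝ) * t i = z 0 * (t 0 + x * t 1 + y * t 2)
        - (z 0 * x - z 1) * (t 1 + s * t 2)
        - (z 0 * y - z 2 - s * (z 0 * x - z 1)) * t 2 := by
      rw [Fin.sum_univ_three]; ring
    rw [e]
    have h0 := abs_le.mp (mul hA₁ z0 t0)
    have h1 := abs_le.mp (mul hA₂ z1 t1)
    have h2 := abs_le.mp (mul hA₃ z2 t2)
    rw [abs_le]
    constructor <;> linarith
  have main := card_mul_volume_le hB hinj S hsmall
  rw [hvol, ← ENNReal.ofReal_mul (by positivity), ENNReal.ofReal_le_ofReal_iff (by positivity)]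
    at main
  rcases S.card.eq_zero_or_pos with h | h
  · rw [h]; push_cast; positivity
  · have hc : (0 : ℝ) < S.card := by exact_mod_cast h
    have hP : 0 < A₁ * A₂ * A₃ := by positivity
    rw [mul_one_div, div_le_iff₀ (by positivity)] at main
    nlinarith

theorem exists_finset_card_le_of_dual_trivial {x y s A₁ A₂ A₃ : ℝ} (hA₁ : 0 < A₁) (hA₂ : 0 < A₂)
    (hA₃ : 0 < A₃) (S : Set (Fin 3 → ℤ))
    (hS : ∀ z ∈ S, |(z 0 : ℝ)| ≤ A₁ ∧ |z 0 * x - z 1| ≤ A₂ ∧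
      |z 0 * y - z 2 - s * (z 0 * x - z 1)| ≤ A₃)
    (hdual : ∀ n : Fin 3 → ℤ, |(n 2 : ℝ)| ≤ 1 / A₃ → |n 1 + n 2 * s| ≤ 1 / A₂ →
      |n 0 + n 1 * x + n 2 * y| ≤ 1 / A₁ → n = 0) :
    ∃ S' : Finset (Fin 3 → ℤ), S = S' ∧ (S'.card : ℝ) ≤ 3456 * (A₁ * A₂ * A₃) := by
  have bound (S' : Finset (Fin 3 → ℤ)) (h : ↑S' ⊆ S) :=
    card_le_of_dual_trivial hA₁ hA₂ hA₃ S' (fun z hz => hS z (h hz)) hdual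
  by_cases hfin : S.Finite
  · exact ⟨hfin.toFinset, hfin.coe_toFinset.symm, bound _ hfin.coe_toFinset.subset⟩
  · obtain ⟨N, hN⟩ := exists_nat_gt (3456 * (A₁ * A₂ * A₃))
    obtain ⟨S', hS', hcard⟩ := Set.Infinite.exists_subset_card_eq hfin N
    have := bound S' hS'
    rw [hcard] at this
    linarith

theorem volume_le_of_abs_sub_le {X : Set ℝ} {d : ℝ}
    (h : ∀ x ∈ X, ∀ y ∈ X, x ≤ y → y - x ≤ d) : volume X ≤ ENNReal.ofReal d := by
  refine (Real.volume_le_diam X).trans (Metric.ediam_le fun x hx y hy => ?_)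
  rw [edist_dist, Real.dist_eq]
  refine ENNReal.ofReal_le_ofReal ?_
  rcases le_total x y with hxy | hxy
  · rw [abs_sub_comm, abs_of_nonneg (by linarith)]; exact h x hx y hy hxy
  · rw [abs_of_nonneg (by linarith)]; exact h y hy x hx hxy

/-- If `X` meets every interval of length `r` in measure at most `b`, then its measure in `[α, β]`
is at most `((β - α) / r + 1) * b`. -/
theorem volume_le_of_forall_Icc {X : Set ℝ} {α β r b : ℝ} (hαβ : α ≤ β) (hr : 0 < r) (hb : 0 ≤ b)
    (hX : X ⊆ Set.Icc α β)
    (h : ∀ t, volume (X ∩ Set.Icc t (t + r)) ≤ ENNReal.ofReal b) :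
    volume X ≤ ENNReal.ofReal (((β - α) / r + 1) * b) := by
  have hq : 0 ≤ (β - α) / r := div_nonneg (by linarith) hr.le
  set K := ⌊(β - α) / r⌋₊ + 1 with hK
  have hcover : X ⊆ ⋃ i ∈ Finset.range K, X ∩ Set.Icc (α + i * r) (α + i * r + r) := by
    intro x hx
    obtain ⟨h1, h2⟩ := hX hx
    have hx0 : 0 ≤ (x - α) / r := div_nonneg (by linarith) hr.le
    refine Set.mem_biUnion (x := ⌊(x - α) / r⌋₊) ?_ ⟨hx, ?_⟩
    · simp only [Finset.coe_range, Set.mem_Iio, hK]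
      exact Nat.lt_succ_of_le (Nat.floor_mono (by gcongr))
    · have a := Nat.floor_le hx0
      have c := Nat.lt_floor_add_one ((x - α) / r)
      rw [le_div_iff₀ hr] at a
      rw [div_lt_iff₀ hr] at c
      constructor <;> linarith
  calc volume X ≤ ∑ i ∈ Finset.range K, volume (X ∩ Set.Icc (α + i * r) (α + i * r + r)) :=
        (measure_mono hcover).trans (measure_biUnion_finset_le _ _)
    _ ≤ ∑ i ∈ Finset.range K, ENNReal.ofReal b := Finset.sum_le_sum fun i _ => h _
    _ = ENNReal.ofReal (K * b) := by
        rw [Finset.sum_const, Finset.card_range, nsmul_eq_mul, ENNReal.ofReal_mul (by positivity),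
          ENNReal.ofReal_natCast]
    _ ≤ _ := by
        refine ENNReal.ofReal_le_ofReal (mul_le_mul_of_nonneg_right ?_ hb)
        rw [hK]; push_cast
        linarith [Nat.floor_le hq]

/-- Uniform bounds for a convex function `f` with derivative `f₁` on `[α, β]`. -/
structure ConvexArc (f f₁ : ℝ → ℝ) (α β c₁ c₂ m M : ℝ) : Prop where
  le : α ≤ β
  c₂_pos : 0 < c₂
  m_pos : 0 < m
  M_pos : 0 < M
  abs_deriv_le : ∀ x ∈ Set.Icc α β, |f₁ x| ≤ c₁
  le_abs_sub : ∀ x ∈ Set.Icc α β, ∀ y ∈ Set.Icc α β, c₂ * |x - y| ≤ |f x - f y|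
  deriv_lipschitz : ∀ x ∈ Set.Icc α β, ∀ y ∈ Set.Icc α β, |f₁ x - f₁ y| ≤ M * |x - y|
  taylor : ∀ x ∈ Set.Icc α β, ∀ y ∈ Set.Icc α β, |f x - f y - f₁ y * (x - y)| ≤ M * (x - y) ^ 2
  deriv_growth : ∀ x ∈ Set.Icc α β, ∀ y ∈ Set.Icc α β, x ≤ y → m * (y - x) ≤ f₁ y - f₁ x
  tangent_right : ∀ x ∈ Set.Icc α β, ∀ y ∈ Set.Icc α β, ∀ a, a ≤ x → x ≤ y →
    m / 2 * ((y - a) ^ 2 - (x - a) ^ 2) ≤ (f x - f₁ x * (x - a)) - (f y - f₁ y * (y - a))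
  tangent_left : ∀ x ∈ Set.Icc α β, ∀ y ∈ Set.Icc α β, ∀ a, x ≤ y → y ≤ a →
    m / 2 * ((x - a) ^ 2 - (y - a) ^ 2) ≤ (f y - f₁ y * (y - a)) - (f x - f₁ x * (x - a))

namespace ConvexArc

variable {f f₁ : ℝ → ℝ} {α β c₁ c₂ m M : ℝ}

/-- The set of points whose tangent line passes close to a fixed point of the projective plane is
small. -/
theorem volume_tangent_le (hf : ConvexArc f f₁ α β c₁ c₂ m M) {q a b r κ : ℝ}
    (hp : q ≠ 0 ∨ a ≠ 0 ∨ b ≠ 0) (hr : 0 < r) (hκ : 0 ≤ κ) {X : Set ℝ} (hX : X ⊆ Set.Icc α β)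
    (h : ∀ x ∈ X, |q * f x - b - f₁ x * (q * x - a)| ≤ |q| * r ^ 2 + κ * |q * x - a|) :
    volume X ≤ ENNReal.ofReal ((2 + 4 / m) * (r + κ)) := by
  have hm := hf.m_pos
  by_cases hq : q = 0
  · subst hq
    simp only [zero_mul, zero_sub, abs_zero, zero_add, abs_neg] at h
    have ha (x : ℝ) (hx : x ∈ X) : a ≠ 0 := by
      rintro rfl
      have := h x hx
      simp only [neg_zero, mul_zero, sub_zero, abs_neg, abs_zero] at this
      have := abs_nonpos_iff.mp this
      simp_all
    refine (volume_le_of_abs_sub_le (d := 2 * κ / m) fun x hx y hy hxy => ?_).trans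
      (ENNReal.ofReal_le_ofReal ?_)
    · have ha0 := abs_pos.mpr (ha x hx)
      have g := hf.deriv_growth x (hX hx) y (hX hy) hxy
      have hd : |(f₁ y - f₁ x) * a| ≤ 2 * κ * |a| := by
        have e : (f₁ y - f₁ x) * a = (-b - f₁ y * -a) - (-b - f₁ x * -a) := by ring
        rw [e]
        refine (abs_sub _ _).trans ?_
        linarith [h x hx, h y hy]
      rw [abs_mul] at hd
      have := le_of_mul_le_mul_right hd ha0
      rw [le_div_iff₀ hm]
      linarith [le_abs_self (f₁ y - f₁ x)]
    · have : 2 * κ / m = (4 / m) * κ / 2 := by ring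
      rw [this]
      have : 0 ≤ 4 / m * κ := by positivity
      have : 0 ≤ 4 / m * r := by positivity
      nlinarith
  set p := a / q with hp'
  have h' : ∀ x ∈ X, |f x - b / q - f₁ x * (x - p)| ≤ r ^ 2 + κ * |x - p| := by
    intro x hx
    have e : q * f x - b - f₁ x * (q * x - a) = q * (f x - b / q - f₁ x * (x - p)) := by
      rw [hp']; field_simp
    have e' : q * x - a = q * (x - p) := by rw [hp']; field_simp
    have := h x hx
    rw [e, e', abs_mul, abs_mul] at this
    refine le_of_mul_le_mul_left ?_ (abs_pos.mpr hq)
    linarith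
  have hnear : volume (X ∩ Set.Icc (p - r) (p + r)) ≤ ENNReal.ofReal (2 * r) :=
    volume_le_of_abs_sub_le fun x hx y hy _ => by linarith [hx.2.1, hy.2.2]
  have final {D S : ℝ} (hS : 2 * r ≤ S) (hD : 0 ≤ D)
      (hle : m / 2 * (D * S) ≤ 2 * r ^ 2 + κ * S) : D ≤ 2 / m * (r + κ) := by
    have hS0 : 0 < S := by linarith
    have : m / 2 * (D * S) ≤ (r + κ) * S := by nlinarith
    have : m / 2 * D ≤ r + κ := le_of_mul_le_mul_right (by linarith) hS0
    rw [div_mul_eq_mul_div, le_div_iff₀ hm]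
    linarith
  have hright : volume (X ∩ Set.Ici (p + r)) ≤ ENNReal.ofReal (2 / m * (r + κ)) := by
    refine volume_le_of_abs_sub_le fun x hx y hy hxy => ?_
    have hx2 : p + r ≤ x := hx.2
    have t := hf.tangent_right x (hX hx.1) y (hX hy.1) p (by linarith) hxy
    have b1 := abs_le.mp (h' x hx.1)
    have b2 := abs_le.mp (h' y hy.1)
    rw [abs_of_nonneg (by linarith : 0 ≤ x - p)] at b1
    rw [abs_of_nonneg (by linarith : 0 ≤ y - p)] at b2
    refine final (S := x - p + (y - p)) (by linarith) (by linarith) ?_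
    nlinarith
  have hleft : volume (X ∩ Set.Iic (p - r)) ≤ ENNReal.ofReal (2 / m * (r + κ)) := by
    refine volume_le_of_abs_sub_le fun x hx y hy hxy => ?_
    have hy2 : y ≤ p - r := hy.2
    have t := hf.tangent_left x (hX hx.1) y (hX hy.1) p hxy (by linarith)
    have b1 := abs_le.mp (h' x hx.1)
    have b2 := abs_le.mp (h' y hy.1)
    rw [abs_of_nonpos (by linarith : x - p ≤ 0)] at b1
    rw [abs_of_nonpos (by linarith : y - p ≤ 0)] at b2
    refine final (S := p - x + (p - y)) (by linarith) (by linarith) ?_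
    nlinarith
  have hcover : X ⊆ (X ∩ Set.Icc (p - r) (p + r)) ∪ (X ∩ Set.Ici (p + r)) ∪
      (X ∩ Set.Iic (p - r)) := by
    intro x hx
    rcases le_total x (p - r) with h1 | h1
    · exact Or.inr ⟨hx, h1⟩
    rcases le_total x (p + r) with h2 | h2
    · exact Or.inl (Or.inl ⟨hx, h1, h2⟩)
    · exact Or.inl (Or.inr ⟨hx, h2⟩)
  have hpos : 0 ≤ 2 / m * (r + κ) := by positivity
  calc volume X ≤ ENNReal.ofReal (2 * r) + ENNReal.ofReal (2 / m * (r + κ)) +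
        ENNReal.ofReal (2 / m * (r + κ)) :=
        (measure_mono hcover).trans <| (measure_union_le _ _).trans <|
          add_le_add ((measure_union_le _ _).trans (add_le_add hnear hright)) hleft
    _ = ENNReal.ofReal (2 * r + 2 / m * (r + κ) + 2 / m * (r + κ)) := by
        rw [ENNReal.ofReal_add (by positivity) hpos, ENNReal.ofReal_add (by positivity) hpos]
    _ ≤ _ := by
        refine ENNReal.ofReal_le_ofReal ?_
        have : 4 / m * (r + κ) = 2 / m * (r + κ) + 2 / m * (r + κ) := by ring
        nlinarith

end ConvexArc

/-- Integer vectors of rank at most two are annihilated by a common nonzero real vector. -/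
theorem exists_common_normal (N : ℤ → ℤ → ℤ → Prop) (hv : ∀ w u v, N w u v → v ≠ 0)
    (hdet : ∀ w u v w' u' v' w'' u'' v'', N w u v → N w' u' v' → N w'' u'' v'' →
      w * (u' * v'' - v' * u'') - u * (w' * v'' - v' * w'') + v * (w' * u'' - u' * w'') = 0) :
    ∃ q a b : ℝ, (q ≠ 0 ∨ a ≠ 0 ∨ b ≠ 0) ∧ ∀ w u v, N w u v → w * q + u * a + v * b = 0 := by
  by_cases hN : ∃ w u v, N w u v
  · obtain ⟨w, u, v, h⟩ := hN
    by_cases hpar : ∀ w' u' v', N w' u' v' → w' * v - v' * w = 0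
    · refine ⟨v, 0, -w, Or.inl (by exact_mod_cast hv w u v h), fun w' u' v' h' => ?_⟩
      have := hpar w' u' v' h'
      have : ((w' * v - v' * w : ℤ) : ℝ) = 0 := by exact_mod_cast this
      push_cast at this
      linarith
    · push Not at hpar
      obtain ⟨w', u', v', h', hne⟩ := hpar
      refine ⟨(u * v' - v * u' : ℤ), (v * w' - w * v' : ℤ), (w * u' - u * w' : ℤ),
        Or.inr (Or.inl ?_), fun w'' u'' v'' h'' => ?_⟩
      · exact_mod_cast fun h0 => hne (by linarith)
      · have := hdet _ _ _ _ _ _ _ _ _ h'' h h'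
        have e : w'' * (u * v' - v * u') + u'' * (v * w' - w * v') +
            v'' * (w * u' - u * w') = 0 :=
          by rw [← this]; ring
        exact_mod_cast e
  · push Not at hN
    exact ⟨1, 0, 0, Or.inl one_ne_zero, fun w u v h => (hN w u v h).elim⟩

theorem abs_det_le {a₁ a₂ a₃ b₁ b₂ b₃ v₁ v₂ v₃ P R W : ℝ} (ha₁ : |a₁| ≤ P) (ha₂ : |a₂| ≤ P)
    (ha₃ : |a₃| ≤ P) (hb₁ : |b₁| ≤ R) (hb₂ : |b₂| ≤ R) (hb₃ : |b₃| ≤ R)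
    (hv₁ : |v₁| ≤ W) (hv₂ : |v₂| ≤ W) (hv₃ : |v₃| ≤ W) :
    |a₁ * (b₂ * v₃ - v₂ * b₃) - b₁ * (a₂ * v₃ - v₂ * a₃) + v₁ * (a₂ * b₃ - b₂ * a₃)| ≤
      6 * (P * R * W) := by
  have mul {a b v : ℝ} (ha : |a| ≤ P) (hb : |b| ≤ R) (hv : |v| ≤ W) :
      -(P * R * W) ≤ a * b * v ∧ a * b * v ≤ P * R * W := by
    rw [← abs_le, abs_mul, abs_mul]
    have := (abs_nonneg a).trans ha
    have := (abs_nonneg b).trans hb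
    gcongr
  have h1 := mul ha₁ hb₂ hv₃
  have h2 := mul ha₁ hb₃ hv₂
  have h3 := mul ha₂ hb₁ hv₃
  have h4 := mul ha₃ hb₁ hv₂
  have h5 := mul ha₂ hb₃ hv₁
  have h6 := mul ha₃ hb₂ hv₁
  rw [abs_le]
  constructor <;> linarith

namespace ConvexArc

variable {f f₁ : ℝ → ℝ} {α β c₁ c₂ m M : ℝ}

theorem volume_scale_Icc_le (hf : ConvexArc f f₁ α β c₁ c₂ m M) {V η τ c : ℝ} (hV : 0 < V)
    (hη : 0 < η) (hτ : τ * V ≤ η ^ 2) (hηc : η ≤ c)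
    (hc : 12 * (c ^ 2 * (2 + 2 * M)) * (c * (1 + 2 * M)) < 1) (t : ℝ) :
    volume ({x | x ∈ Set.Icc α β ∧ ∃ w u v : ℤ, V ≤ |(v : ℝ)| ∧ |(v : ℝ)| ≤ 2 * V ∧
      |u + v * f₁ x| ≤ η ∧ |w + u * x + v * f x| ≤ τ} ∩ Set.Icc t (t + c / V)) ≤
        ENNReal.ofReal ((2 + 4 / m) * (2 * η / V)) := by
  set X := {x | x ∈ Set.Icc α β ∧ ∃ w u v : ℤ, V ≤ |(v : ℝ)| ∧ |(v : ℝ)| ≤ 2 * V ∧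
      |u + v * f₁ x| ≤ η ∧ |w + u * x + v * f x| ≤ τ} ∩ Set.Icc t (t + c / V) with hX
  rcases X.eq_empty_or_nonempty with h | ⟨x₀, hx₀⟩
  · rw [h]; simp
  have hM := hf.M_pos
  have hc0 : 0 < c := hη.trans_le hηc
  let N : ℤ → ℤ → ℤ → Prop := fun w u v => V ≤ |(v : ℝ)| ∧ |(v : ℝ)| ≤ 2 * V ∧
    ∃ x ∈ X, |u + v * f₁ x| ≤ η ∧ |w + u * x + v * f x| ≤ τ
  have hest (w u v : ℤ) (h : N w u v) : |w + u * x₀ + v * f x₀| ≤ c ^ 2 * (2 + 2 * M) / V ∧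
      |u + v * f₁ x₀| ≤ c * (1 + 2 * M) ∧ |(v : ℝ)| ≤ 2 * V := by
    obtain ⟨hv1, hv2, x, hx, h1, h2⟩ := h
    have hxx : |x₀ - x| ≤ c / V := by
      rw [abs_le]
      constructor <;> linarith [hx.2.1, hx.2.2, hx₀.2.1, hx₀.2.2]
    refine ⟨?_, ?_, hv2⟩
    · have e : w + u * x₀ + v * f x₀ = (w + u * x + v * f x) + (u + v * f₁ x) * (x₀ - x) +
          v * (f x₀ - f x - f₁ x * (x₀ - x)) := by ring
      have hT : |f x₀ - f x - f₁ x * (x₀ - x)| ≤ M * (c / V) ^ 2 := by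
        refine (hf.taylor x₀ hx₀.1.1 x hx.1.1).trans ?_
        rw [← sq_abs]
        gcongr
      rw [e]
      calc _ ≤ |w + u * x + v * f x| + |(u + v * f₁ x) * (x₀ - x)| +
            |v * (f x₀ - f x - f₁ x * (x₀ - x))| := abs_add_three _ _ _
        _ ≤ τ + η * (c / V) + 2 * V * (M * (c / V) ^ 2) := by
            rw [abs_mul, abs_mul]
            gcongr
        _ = (τ * V + η * c + 2 * M * c ^ 2) / V := by field_simp
        _ ≤ _ := by
            gcongr
            nlinarith
    · have e : u + v * f₁ x₀ = (u + v * f₁ x) + v * (f₁ x₀ - f₁ x) := by ring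
      have hL : |f₁ x₀ - f₁ x| ≤ M * (c / V) := by
        refine (hf.deriv_lipschitz x₀ hx₀.1.1 x hx.1.1).trans ?_
        gcongr
      rw [e]
      calc _ ≤ |u + v * f₁ x| + |v * (f₁ x₀ - f₁ x)| := abs_add_le _ _
        _ ≤ η + 2 * V * (M * (c / V)) := by
            rw [abs_mul]
            gcongr
        _ = η + 2 * M * c := by field_simp
        _ ≤ _ := by linarith
  obtain ⟨q, a, b, hp, hN⟩ := exists_common_normal N
    (by
      rintro w u v ⟨h, -⟩ rfl
      simp at h
      linarith)
    (by
      intro w u v w' u' v' w'' u'' v'' h h' h''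
      obtain ⟨e1, e2, e3⟩ := hest _ _ _ h
      obtain ⟨e1', e2', e3'⟩ := hest _ _ _ h'
      obtain ⟨e1'', e2'', e3''⟩ := hest _ _ _ h''
      have hle := abs_det_le e1 e1' e1'' e2 e2' e2'' e3 e3' e3''
      have e : 6 * (c ^ 2 * (2 + 2 * M) / V * (c * (1 + 2 * M)) * (2 * V)) =
          12 * (c ^ 2 * (2 + 2 * M)) * (c * (1 + 2 * M)) := by field_simp; ring
      rw [e] at hle
      have hlt := hle.trans_lt hc
      rw [← Int.abs_lt_one_iff]
      have : |((w * (u' * v'' - v' * u'') - u * (w' * v'' - v' * w'') +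
          v * (w' * u'' - u' * w'') : ℤ) : ℝ)| < 1 := by
        refine lt_of_eq_of_lt ?_ hlt
        congr 1
        push_cast
        ring
      exact_mod_cast this)
  have hηV : 0 < η / V := by positivity
  refine (hf.volume_tangent_le hp hηV hηV.le (fun x hx => hx.1.1) fun x hx => ?_).trans
    (le_of_eq (by congr 1; ring))
  obtain ⟨w, u, v, hv1, hv2, h1, h2⟩ := hx.1.2
  have h0 := hN w u v ⟨hv1, hv2, x, hx, h1, h2⟩
  set G := q * f x - b - f₁ x * (q * x - a) with hG
  have e : v * G = q * (w + u * x + v * f x) - (u + v * f₁ x) * (q * x - a) := by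
    rw [hG]
    linear_combination -h0
  have hvG : V * |G| ≤ |q| * τ + η * |q * x - a| := by
    calc V * |G| ≤ |(v : ℝ)| * |G| := by gcongr
      _ = |q * (w + u * x + v * f x) - (u + v * f₁ x) * (q * x - a)| := by rw [← abs_mul, e]
      _ ≤ |q * (w + u * x + v * f x)| + |(u + v * f₁ x) * (q * x - a)| := abs_sub _ _
      _ ≤ _ := by
          rw [abs_mul, abs_mul]
          gcongr
  have hτ' : τ ≤ η ^ 2 / V := by rwa [le_div_iff₀ hV]
  calc |G| = V * |G| / V := by field_simp
    _ ≤ (|q| * (η ^ 2 / V) + η * |q * x - a|) / V := by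
        gcongr
        refine hvG.trans ?_
        gcongr
    _ = |q| * (η / V) ^ 2 + η / V * |q * x - a| := by field_simp

end ConvexArc

/-- The points at which the parallelepiped dual to the rational points with denominator about `Q`
at distance `δ / Q` from the curve contains a nonzero integer vector. -/
def dualBad (f f₁ : ℝ → ℝ) (Q δ : ℝ) : Set ℝ :=
  {x | ∃ w u v : ℤ, ¬ (w = 0 ∧ u = 0 ∧ v = 0) ∧ |(v : ℝ)| ≤ 1 / δ ∧
    |u + v * f₁ x| ≤ 1 / √(δ * Q) ∧ |w + u * x + v * f x| ≤ 1 / Q}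

namespace ConvexArc

variable {f f₁ : ℝ → ℝ} {α β c₁ c₂ m M : ℝ}

theorem exists_volume_dualBad_le (hf : ConvexArc f f₁ α β c₁ c₂ m M) :
    ∃ C : ℝ, 0 < C ∧ ∀ (Q δ : ℝ) (K : ℕ), 0 < Q → 0 < δ → δ ≤ 1 → 1 / δ < 2 ^ K →
      volume (Set.Icc α β ∩ dualBad f f₁ Q δ) ≤
        ENNReal.ofReal (C * ((K + 1) * (1 / √(δ * Q)))) := by
  have hM := hf.M_pos
  have hm := hf.m_pos
  have hαβ : 0 ≤ β - α := sub_nonneg.mpr hf.le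
  set Y : ℝ := (2 + 2 * M) * (1 + 2 * M) with hY
  have hY2 : 2 ≤ Y := by rw [hY]; nlinarith
  set c : ℝ := 1 / (24 * Y) with hcdef
  have hc0 : 0 < c := by positivity
  have hcY : c * Y = 1 / 24 := by rw [hcdef]; field_simp
  have hc1 : c < 1 := by nlinarith
  have hc : 12 * (c ^ 2 * (2 + 2 * M)) * (c * (1 + 2 * M)) < 1 := by
    have e : 12 * (c ^ 2 * (2 + 2 * M)) * (c * (1 + 2 * M)) = 12 * c ^ 2 * (c * Y) := by
      rw [hY]; ring
    rw [e, hcY]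
    nlinarith
  set D : ℝ := ((β - α) / c + 1) * ((2 + 4 / m) * 2) with hD
  have hD0 : 0 < D := by positivity
  refine ⟨D + (β - α) / c, by positivity, fun Q δ K hQ hδ hδ1 hK => ?_⟩
  set η := 1 / √(δ * Q) with hη
  have hη0 : 0 < η := by positivity
  rcases lt_or_ge c η with hcη | hηc
  · calc volume (Set.Icc α β ∩ dualBad f f₁ Q δ) ≤ volume (Set.Icc α β) :=
          measure_mono Set.inter_subset_left
      _ = ENNReal.ofReal (β - α) := Real.volume_Icc
      _ ≤ _ := by
          refine ENNReal.ofReal_le_ofReal ?_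
          calc β - α = (β - α) / c * (1 * c) := by field_simp
            _ ≤ (D + (β - α) / c) * ((K + 1) * η) := by
              gcongr
              · linarith
              · linarith [(Nat.cast_nonneg K : (0 : ℝ) ≤ K)]
  have hη2 : η ^ 2 = 1 / (δ * Q) := by
    rw [hη, div_pow, one_pow, Real.sq_sqrt (by positivity)]
  have hη1 : η < 1 := hηc.trans_lt hc1
  have hQ1 : 1 / Q < 1 := by
    have h1 : 1 / (δ * Q) < 1 := by rw [← hη2]; nlinarith
    rw [div_lt_one (by positivity)] at h1 ⊢
    nlinarith
  have scale (i : ℕ) (hi : (2 : ℝ) ^ i ≤ 1 / δ) :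
      volume {x | x ∈ Set.Icc α β ∧ ∃ w u v : ℤ, (2 : ℝ) ^ i ≤ |(v : ℝ)| ∧
        |(v : ℝ)| ≤ 2 * 2 ^ i ∧ |u + v * f₁ x| ≤ η ∧ |w + u * x + v * f x| ≤ 1 / Q} ≤
        ENNReal.ofReal (D * η) := by
    have hV : (0 : ℝ) < 2 ^ i := by positivity
    have hV1 : (1 : ℝ) ≤ 2 ^ i := one_le_pow₀ one_le_two
    have hτ : 1 / Q * (2 : ℝ) ^ i ≤ η ^ 2 := by
      rw [hη2]
      calc 1 / Q * (2 : ℝ) ^ i ≤ 1 / Q * (1 / δ) := by gcongr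
        _ = _ := by field_simp
    refine (volume_le_of_forall_Icc hf.le (by positivity : 0 < c / 2 ^ i) (by positivity)
      (fun x hx => hx.1) (hf.volume_scale_Icc_le hV hη0 hτ hηc hc)).trans
      (ENNReal.ofReal_le_ofReal ?_)
    have e : D * η = ((β - α) / c * 2 ^ i + 2 ^ i) * ((2 + 4 / m) * (2 * η / 2 ^ i)) := by
      rw [hD]; field_simp
    rw [e]
    gcongr
    exact (by field_simp : (β - α) / (c / 2 ^ i) = (β - α) / c * 2 ^ i).le
  let Z : ℕ → Set ℝ := fun i => {x | (2 : ℝ) ^ i ≤ 1 / δ ∧ x ∈ Set.Icc α β ∧ ∃ w u v : ℤ,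
    (2 : ℝ) ^ i ≤ |(v : ℝ)| ∧ |(v : ℝ)| ≤ 2 * 2 ^ i ∧ |u + v * f₁ x| ≤ η ∧
      |w + u * x + v * f x| ≤ 1 / Q}
  have hZ (i : ℕ) : volume (Z i) ≤ ENNReal.ofReal (D * η) := by
    by_cases hi : (2 : ℝ) ^ i ≤ 1 / δ
    · exact (measure_mono fun x hx => hx.2).trans (scale i hi)
    · have : Z i = ∅ := Set.eq_empty_of_forall_notMem fun x hx => hi hx.1
      rw [this]; simp
  have hcover : Set.Icc α β ∩ dualBad f f₁ Q δ ⊆ ⋃ i ∈ Finset.range K, Z i := by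
    rintro x ⟨hx, w, u, v, hne, hv, hu, hw⟩
    have small {n : ℤ} (h : |(n : ℝ)| < 1) : n = 0 := by
      rw [← Int.abs_lt_one_iff]; exact_mod_cast h
    have hv0 : v ≠ 0 := by
      rintro rfl
      have hu0 : u = 0 := small (lt_of_le_of_lt (show |(u : ℝ)| ≤ η by simpa [hη] using hu) hη1)
      subst hu0
      exact hne ⟨small (lt_of_le_of_lt (by simpa using hw) hQ1), rfl, rfl⟩
    have hcast : ((v.natAbs : ℕ) : ℝ) = |(v : ℝ)| := by
      rw [Nat.cast_natAbs]; push_cast; rfl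
    have hlow : (2 : ℝ) ^ (Nat.log 2 v.natAbs) ≤ |(v : ℝ)| := by
      rw [← hcast]
      exact_mod_cast Nat.pow_log_le_self 2 (Int.natAbs_ne_zero.mpr hv0)
    have hupp : |(v : ℝ)| ≤ 2 * 2 ^ (Nat.log 2 v.natAbs) := by
      rw [← hcast, ← pow_succ']
      exact_mod_cast (Nat.lt_pow_succ_log_self one_lt_two v.natAbs).le
    refine Set.mem_biUnion (x := Nat.log 2 v.natAbs) ?_
      ⟨hlow.trans hv, hx, w, u, v, hlow, hupp, hu, hw⟩
    simp only [Finset.coe_range, Set.mem_Iio]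
    exact (pow_lt_pow_iff_right₀ (one_lt_two (α := ℝ))).mp ((hlow.trans hv).trans_lt hK)
  calc volume (Set.Icc α β ∩ dualBad f f₁ Q δ) ≤ ∑ i ∈ Finset.range K, volume (Z i) :=
        (measure_mono hcover).trans (measure_biUnion_finset_le _ _)
    _ ≤ ∑ i ∈ Finset.range K, ENNReal.ofReal (D * η) := Finset.sum_le_sum fun i _ => hZ i
    _ = ENNReal.ofReal (K * (D * η)) := by
        rw [Finset.sum_const, Finset.card_range, nsmul_eq_mul,
          ENNReal.ofReal_mul (Nat.cast_nonneg K), ENNReal.ofReal_natCast]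
    _ ≤ _ := by
        refine ENNReal.ofReal_le_ofReal ?_
        calc K * (D * η) = D * (K * η) := by ring
          _ ≤ (D + (β - α) / c) * ((K + 1) * η) := by
            have : 0 ≤ (β - α) / c := by positivity
            gcongr <;> linarith

theorem volume_near_rational_le (hf : ConvexArc f f₁ α β c₁ c₂ m M) {Q δ₁ δ₂ : ℝ} (hQ : 0 < Q)
    (hδ₁ : 0 < δ₁) (hδ₂ : 0 < δ₂) {q p₁ p₂ : ℤ} (hq : Q ≤ q) :
    volume {x | x ∈ Set.Icc α β ∧ |q * x - p₁| < δ₁ ∧ |q * f x - p₂| < δ₂} ≤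
      ENNReal.ofReal (2 * (1 + 1 / c₂) * (min δ₁ δ₂ / Q)) := by
  have hc₂ := hf.c₂_pos
  have hq0 : (0 : ℝ) < q := hQ.trans_le hq
  refine volume_le_of_abs_sub_le fun x hx y hy hxy => ?_
  obtain ⟨hx, hx1, hx2⟩ := hx
  obtain ⟨hy, hy1, hy2⟩ := hy
  have h1 : Q * (y - x) ≤ 2 * δ₁ := by
    calc Q * (y - x) ≤ q * (y - x) := mul_le_mul_of_nonneg_right hq (by linarith)
      _ ≤ 2 * δ₁ := by linarith [(abs_lt.mp hx1).1, (abs_lt.mp hy1).2]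
  have h2 : Q * (y - x) ≤ 2 * δ₂ / c₂ := by
    rw [le_div_iff₀ hc₂]
    have g := hf.le_abs_sub y hy x hx
    rw [abs_of_nonneg (sub_nonneg.mpr hxy)] at g
    calc Q * (y - x) * c₂ = Q * (c₂ * (y - x)) := by ring
      _ ≤ q * |f y - f x| := by
        have : 0 ≤ c₂ * (y - x) := mul_nonneg hc₂.le (by linarith)
        gcongr
      _ = |(q * f y - p₂) - (q * f x - p₂)| := by
        rw [← abs_of_pos hq0, ← abs_mul, abs_of_pos hq0]; congr 1; ring
      _ ≤ 2 * δ₂ := (abs_sub _ _).trans (by linarith)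
  have h3 : Q * (y - x) ≤ 2 * (1 + 1 / c₂) * min δ₁ δ₂ := by
    have : 0 < 1 / c₂ := by positivity
    rcases min_cases δ₁ δ₂ with ⟨e, -⟩ | ⟨e, -⟩ <;> rw [e]
    · nlinarith
    · have e : 2 * δ₂ / c₂ = 2 * (1 / c₂) * δ₂ := by ring
      rw [e] at h2
      nlinarith
  rw [← mul_div_assoc, le_div_iff₀ hQ]
  linarith

theorem exists_volume_good_le (hf : ConvexArc f f₁ α β c₁ c₂ m M) :
    ∃ C : ℝ, 0 < C ∧ ∀ (Q δ₁ δ₂ : ℝ), 1 ≤ Q → 0 < δ₁ → 0 < δ₂ → δ₁ ≤ 1 → δ₂ ≤ 1 →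
      volume {x | x ∈ Set.Icc α β ∧ x ∉ dualBad f f₁ Q (max δ₁ δ₂) ∧ ∃ q p₁ p₂ : ℤ,
        Q ≤ q ∧ q ≤ 2 * Q ∧ |q * x - p₁| < δ₁ ∧ |q * f x - p₂| < δ₂} ≤
        ENNReal.ofReal (C * (Q * (δ₁ * δ₂))) := by
  have hM := hf.M_pos
  have hc₂ := hf.c₂_pos
  have hαβ : 0 ≤ β - α := sub_nonneg.mpr hf.le
  have hc₁ : 0 ≤ c₁ := (abs_nonneg _).trans (hf.abs_deriv_le α ⟨le_rfl, hf.le⟩)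
  set E : ℝ := 2 * M + 1 + c₁ with hE
  have hE0 : 0 < E := by positivity
  refine ⟨(β - α + 1) * (3456 * 6 * E * (2 * (1 + 1 / c₂))), by positivity,
    fun Q δ₁ δ₂ hQ hδ₁ hδ₂ hδ₁1 hδ₂1 => ?_⟩
  have hQ0 : 0 < Q := by linarith
  set δ := max δ₁ δ₂ with hδ
  have hδ0 : 0 < δ := lt_max_of_lt_left hδ₁
  have hδ1 : δ ≤ 1 := max_le hδ₁1 hδ₂1
  set L := √(δ * Q) / Q with hL
  have hL0 : 0 < L := by positivity
  have hQL : Q * L = √(δ * Q) := by rw [hL]; field_simp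
  have hQL2 : Q * L ^ 2 = δ := by
    have : (Q * L) ^ 2 = δ * Q := by rw [hQL, Real.sq_sqrt (by positivity)]
    have : Q * (Q * L ^ 2) = Q * δ := by linarith
    exact mul_left_cancel₀ hQ0.ne' this
  have hδQL : δ ≤ Q * L := by
    rw [hQL]
    exact Real.le_sqrt_of_sq_le (by nlinarith)
  have hL1 : L ≤ 1 := by nlinarith
  refine (volume_le_of_forall_Icc (b := 3456 * (2 * Q * (3 * (Q * L)) * (E * δ)) *
    (2 * (1 + 1 / c₂) * (min δ₁ δ₂ / Q))) hf.le hL0 (by positivity) (fun x hx => hx.1)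
      fun t => ?_).trans (ENNReal.ofReal_le_ofReal ?_)
  swap
  · have e : ((β - α) / L + 1) * (3456 * (2 * Q * (3 * (Q * L)) * (E * δ)) *
        (2 * (1 + 1 / c₂) * (min δ₁ δ₂ / Q))) =
        (β - α + L) * (3456 * 6 * E * (2 * (1 + 1 / c₂))) * (Q * (min δ₁ δ₂ * δ)) := by
      field_simp
      ring
    rw [e, hδ, min_mul_max]
    gcongr
  set X := {x | x ∈ Set.Icc α β ∧ x ∉ dualBad f f₁ Q δ ∧ ∃ q p₁ p₂ : ℤ,
        Q ≤ q ∧ q ≤ 2 * Q ∧ |q * x - p₁| < δ₁ ∧ |q * f x - p₂| < δ₂} ∩ Set.Icc t (t + L)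
  rcases X.eq_empty_or_nonempty with h | ⟨x₀, hx₀⟩
  · rw [h]; simp
  let A : Set (Fin 3 → ℤ) := {z | Q ≤ z 0 ∧ z 0 ≤ 2 * Q ∧
    ∃ x ∈ X, |z 0 * x - z 1| < δ₁ ∧ |z 0 * f x - z 2| < δ₂}
  have hA : ∀ z ∈ A, |(z 0 : ℝ)| ≤ 2 * Q ∧ |z 0 * x₀ - z 1| ≤ 3 * (Q * L) ∧
      |z 0 * f x₀ - z 2 - f₁ x₀ * (z 0 * x₀ - z 1)| ≤ E * δ := by
    rintro z ⟨hz1, hz2, x, hx, h1, h2⟩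
    have hz0 : |(z 0 : ℝ)| ≤ 2 * Q := by rw [abs_of_nonneg (by linarith)]; exact hz2
    have hxx : |x - x₀| ≤ L := by
      rw [abs_le]
      constructor <;> linarith [hx.2.1, hx.2.2, hx₀.2.1, hx₀.2.2]
    have hd1 : δ₁ ≤ δ := le_max_left _ _
    have hd2 : δ₂ ≤ δ := le_max_right _ _
    refine ⟨hz0, ?_, ?_⟩
    · have e : z 0 * x₀ - z 1 = (z 0 * x - z 1) - z 0 * (x - x₀) := by ring
      rw [e]
      calc _ ≤ |z 0 * x - z 1| + |z 0 * (x - x₀)| := abs_sub _ _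
        _ ≤ Q * L + 2 * Q * L := by
            rw [abs_mul]
            gcongr
            linarith
        _ = _ := by ring
    · have e : z 0 * f x₀ - z 2 - f₁ x₀ * (z 0 * x₀ - z 1) = (z 0 * f x - z 2) +
          -(f₁ x₀ * (z 0 * x - z 1)) + -(z 0 * (f x - f x₀ - f₁ x₀ * (x - x₀))) := by ring
      rw [e]
      calc _ ≤ |z 0 * f x - z 2| + |-(f₁ x₀ * (z 0 * x - z 1))| +
            |-(z 0 * (f x - f x₀ - f₁ x₀ * (x - x₀)))| := abs_add_three _ _ _
        _ ≤ δ + c₁ * δ + 2 * Q * (M * L ^ 2) := by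
            rw [abs_neg, abs_neg, abs_mul, abs_mul]
            have hT : |f x - f x₀ - f₁ x₀ * (x - x₀)| ≤ M * L ^ 2 := by
              refine (hf.taylor x hx.1.1 x₀ hx₀.1.1).trans ?_
              rw [← sq_abs]
              gcongr
            have := hf.abs_deriv_le x₀ hx₀.1.1
            gcongr
            · linarith
            · linarith
        _ = δ + c₁ * δ + 2 * M * (Q * L ^ 2) := by ring
        _ = E * δ := by rw [hQL2, hE]; ring
  obtain ⟨S, hAS, hcard⟩ := exists_finset_card_le_of_dual_trivial (by positivity) (by positivity)
    (by positivity) A hA (by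
      intro n h2 h1 h0
      by_contra hn
      refine hx₀.1.2.1 ⟨n 0, n 1, n 2, ?_, h2.trans ?_, h1.trans ?_, h0.trans ?_⟩
      · rintro ⟨e0, e1, e2⟩
        exact hn (funext fun i => by fin_cases i <;> assumption)
      · exact one_div_le_one_div_of_le hδ0 (by nlinarith)
      · rw [← hQL]
        exact one_div_le_one_div_of_le (by positivity) (by nlinarith)
      · exact one_div_le_one_div_of_le hQ0 (by linarith))
  have hcover : X ⊆ ⋃ z ∈ S, {x | x ∈ Set.Icc α β ∧ |z 0 * x - z 1| < δ₁ ∧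
      |z 0 * f x - z 2| < δ₂} := by
    intro x hx
    obtain ⟨q, p₁, p₂, hq, hq', h1, h2⟩ := hx.1.2.2
    have : ![q, p₁, p₂] ∈ A := ⟨hq, hq', x, hx, h1, h2⟩
    rw [hAS] at this
    exact Set.mem_biUnion this ⟨hx.1.1, h1, h2⟩
  calc volume X ≤ ∑ z ∈ S, volume {x | x ∈ Set.Icc α β ∧ |z 0 * x - z 1| < δ₁ ∧
        |z 0 * f x - z 2| < δ₂} := (measure_mono hcover).trans (measure_biUnion_finset_le _ _)
    _ ≤ ∑ z ∈ S, ENNReal.ofReal (2 * (1 + 1 / c₂) * (min δ₁ δ₂ / Q)) := by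
        refine Finset.sum_le_sum fun z hz => hf.volume_near_rational_le hQ0 hδ₁ hδ₂ ?_
        have : z ∈ A := by rw [hAS]; exact hz
        exact this.1
    _ = ENNReal.ofReal (S.card * (2 * (1 + 1 / c₂) * (min δ₁ δ₂ / Q))) := by
        rw [Finset.sum_const, nsmul_eq_mul, ENNReal.ofReal_mul (Nat.cast_nonneg S.card),
          ENNReal.ofReal_natCast]
    _ ≤ _ := by
        refine ENNReal.ofReal_le_ofReal ?_
        gcongr

end ConvexArc

theorem exists_mean_value {h h' : ℝ → ℝ} {α β : ℝ} (hh : ∀ x ∈ Set.Icc α β, HasDerivAt h (h' x) x)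
    {x y : ℝ} (hx : x ∈ Set.Icc α β) (hy : y ∈ Set.Icc α β) (hxy : x ≤ y) :
    ∃ ξ ∈ Set.Icc x y, h y - h x = h' ξ * (y - x) := by
  rcases hxy.eq_or_lt with rfl | hlt
  · exact ⟨x, ⟨le_rfl, le_rfl⟩, by simp⟩
  have hsub : Set.Icc x y ⊆ Set.Icc α β := Set.Icc_subset_Icc hx.1 hy.2
  obtain ⟨ξ, hξ, e⟩ := exists_hasDerivAt_eq_slope h h' hlt
    (fun s hs => (hh s (hsub hs)).continuousAt.continuousWithinAt)
    (fun s hs => hh s (hsub (Set.Ioo_subset_Icc_self hs)))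
  refine ⟨ξ, Set.Ioo_subset_Icc_self hξ, ?_⟩
  have : y - x ≠ 0 := by linarith
  rw [e]; field_simp

theorem exists_mean_value_abs {h h' : ℝ → ℝ} {α β : ℝ}
    (hh : ∀ x ∈ Set.Icc α β, HasDerivAt h (h' x) x)
    {x y : ℝ} (hx : x ∈ Set.Icc α β) (hy : y ∈ Set.Icc α β) :
    ∃ ξ ∈ Set.Icc α β, |ξ - y| ≤ |x - y| ∧ h x - h y = h' ξ * (x - y) := by
  rcases le_total x y with hxy | hxy
  · obtain ⟨ξ, hξ, e⟩ := exists_mean_value hh hx hy hxy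
    refine ⟨ξ, ⟨hx.1.trans hξ.1, hξ.2.trans hy.2⟩, ?_, by linarith⟩
    rw [abs_of_nonpos (by linarith [hξ.2]), abs_of_nonpos (by linarith)]
    linarith [hξ.1]
  · obtain ⟨ξ, hξ, e⟩ := exists_mean_value hh hy hx hxy
    refine ⟨ξ, ⟨hy.1.trans hξ.1, hξ.2.trans hx.2⟩, ?_, e⟩
    rw [abs_of_nonneg (by linarith [hξ.1]), abs_of_nonneg (by linarith)]
    linarith [hξ.2]

theorem ConvexArc.of_hasDerivAt {f f₁ f₂ : ℝ → ℝ} {α β c₁ c₂ m M : ℝ} (hαβ : α ≤ β) (hc₂ : 0 < c₂)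
    (hm : 0 < m) (h1 : ∀ x ∈ Set.Icc α β, HasDerivAt f (f₁ x) x)
    (h2 : ∀ x ∈ Set.Icc α β, HasDerivAt f₁ (f₂ x) x)
    (hf₁ : ∀ x ∈ Set.Icc α β, c₂ ≤ |f₁ x| ∧ |f₁ x| ≤ c₁)
    (hf₂ : ∀ x ∈ Set.Icc α β, m ≤ f₂ x ∧ f₂ x ≤ M) : ConvexArc f f₁ α β c₁ c₂ m M := by
  have hM : 0 < M := hm.trans_le ((hf₂ α ⟨le_rfl, hαβ⟩).1.trans (hf₂ α ⟨le_rfl, hαβ⟩).2)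
  have hlip : ∀ x ∈ Set.Icc α β, ∀ y ∈ Set.Icc α β, |f₁ x - f₁ y| ≤ M * |x - y| := by
    intro x hx y hy
    obtain ⟨ξ, hξ, -, e⟩ := exists_mean_value_abs h2 hx hy
    have := hf₂ ξ hξ
    rw [e, abs_mul, abs_of_pos (hm.trans_le this.1)]
    gcongr
    exact this.2
  have htan (a : ℝ) : ∀ s ∈ Set.Icc α β,
      HasDerivAt (fun s => f s - f₁ s * (s - a) + m / 2 * (s - a) ^ 2)
        ((m - f₂ s) * (s - a)) s := by
    intro s hs
    have hid : HasDerivAt (fun s : ℝ => s - a) 1 s := (hasDerivAt_id s).sub_const a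
    exact (((h1 s hs).sub ((h2 s hs).mul hid)).add ((hid.pow 2).const_mul (m / 2))).congr_deriv
      (by push_cast; ring)
  refine ⟨hαβ, hc₂, hm, hM, fun x hx => (hf₁ x hx).2, ?_, hlip, ?_, ?_, ?_, ?_⟩
  · intro x hx y hy
    obtain ⟨ξ, hξ, -, e⟩ := exists_mean_value_abs h1 hx hy
    rw [e, abs_mul]
    gcongr
    exact (hf₁ ξ hξ).1
  · intro x hx y hy
    obtain ⟨ξ, hξ, hle, e⟩ := exists_mean_value_abs h1 hx hy
    rw [e, ← sub_mul, abs_mul, ← sq_abs (x - y)]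
    have := hlip ξ hξ y hy
    calc _ ≤ M * |x - y| * |x - y| := by
          refine mul_le_mul_of_nonneg_right (this.trans ?_) (abs_nonneg _)
          gcongr
      _ = _ := by ring
  · intro x hx y hy hxy
    obtain ⟨ξ, hξ, e⟩ := exists_mean_value h2 hx hy hxy
    rw [e]
    exact mul_le_mul_of_nonneg_right (hf₂ ξ ⟨hx.1.trans hξ.1, hξ.2.trans hy.2⟩).1 (by linarith)
  · intro x hx y hy a hax hxy
    obtain ⟨ξ, hξ, e⟩ := exists_mean_value (htan a) hx hy hxy
    have h0 := (hf₂ ξ ⟨hx.1.trans hξ.1, hξ.2.trans hy.2⟩).1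
    have : 0 ≤ (f₂ ξ - m) * (ξ - a) * (y - x) :=
      mul_nonneg (mul_nonneg (by linarith) (by linarith [hξ.1])) (by linarith)
    linarith
  · intro x hx y hy a hxy hya
    obtain ⟨ξ, hξ, e⟩ := exists_mean_value (htan a) hx hy hxy
    have h0 := (hf₂ ξ ⟨hx.1.trans hξ.1, hξ.2.trans hy.2⟩).1
    have : 0 ≤ (f₂ ξ - m) * (a - ξ) * (y - x) :=
      mul_nonneg (mul_nonneg (by linarith) (by linarith [hξ.2])) (by linarith)
    linarith

theorem nint_eq_abs_sub_round (x : ℝ) : nint x = |x - round x| := by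
  have hbdd : BddBelow (Set.range fun z : ℤ => |x - (z : ℝ)|) :=
    ⟨0, by rintro _ ⟨z, rfl⟩; exact abs_nonneg _⟩
  exact le_antisymm (ciInf_le hbdd (round x)) (le_ciInf fun z => round_le x z)

theorem nint_nonneg (x : ℝ) : 0 ≤ nint x := by
  rw [nint_eq_abs_sub_round]; exact abs_nonneg _

theorem nint_le_half (x : ℝ) : nint x ≤ 1 / 2 := by
  rw [nint_eq_abs_sub_round]; exact abs_sub_round x

theorem nint_neg (x : ℝ) : nint (-x) = nint x := by
  have h (x : ℝ) : nint (-x) ≤ nint x := by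
    rw [nint_eq_abs_sub_round, nint_eq_abs_sub_round x]
    refine (round_le (-x) (-round x)).trans (le_of_eq ?_)
    push_cast
    rw [← abs_neg]
    congr 1
    ring
  exact le_antisymm (h x) (by simpa using h (-x))

theorem exists_half_pow_le {a : ℝ} (ha : a < 1) {n : ℕ} (hn : (1 / 2 : ℝ) ^ n ≤ a) :
    ∃ k < n, (1 / 2 : ℝ) ^ (k + 1) ≤ a ∧ a < (1 / 2) ^ k := by
  induction n with
  | zero => simp at hn; linarith
  | succ n ih =>
    rcases le_or_gt ((1 / 2 : ℝ) ^ n) a with h | h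
    · obtain ⟨k, hk, h'⟩ := ih h
      exact ⟨k, hk.trans n.lt_succ_self, h'⟩
    · exact ⟨n, n.lt_succ_self, hn, h⟩

namespace ConvexArc

variable {f f₁ : ℝ → ℝ} {α β c₁ c₂ m M : ℝ}

theorem exists_volume_box_le (hf : ConvexArc f f₁ α β c₁ c₂ m M) {g : ℝ} (hg0 : 0 < g)
    (hg : g ^ 8 = 1 / 2) :
    ∃ C : ℝ, 0 < C ∧ ∀ (j : ℕ) (δ₁ δ₂ : ℝ), 0 < δ₁ → 0 < δ₂ → δ₁ ≤ 1 → δ₂ ≤ 1 →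
      g ^ (6 * j) ≤ max δ₁ δ₂ →
      volume {x | x ∈ Set.Icc α β ∧ ∃ q : ℕ, 2 ^ j ≤ q ∧ q < 2 ^ (j + 1) ∧
        nint (q * x) < δ₁ ∧ nint (q * f x) < δ₂} ≤
        ENNReal.ofReal (C * (2 ^ j * (δ₁ * δ₂) + (j + 2) * g ^ j)) := by
  obtain ⟨C₁, hC₁, hbad⟩ := hf.exists_volume_dualBad_le
  obtain ⟨C₂, hC₂, hgood⟩ := hf.exists_volume_good_le
  have hg1 : g < 1 := by
    by_contra! h
    have := one_le_pow₀ (n := 8) h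
    linarith
  have h2 (i : ℕ) : (2 : ℝ) ^ i * g ^ (8 * i) = 1 := by
    rw [pow_mul, hg, ← mul_pow]; norm_num
  refine ⟨C₁ + C₂, by positivity, fun j δ₁ δ₂ hδ₁ hδ₂ hδ₁1 hδ₂1 hδ => ?_⟩
  have hQ0 : (0 : ℝ) < 2 ^ j := by positivity
  have hgj : 0 < g ^ j := by positivity
  have hδ0 : 0 < max δ₁ δ₂ := lt_max_of_lt_left hδ₁
  have hK : 1 / max δ₁ δ₂ < 2 ^ (j + 1) := by
    rw [div_lt_iff₀ hδ0]
    calc (1 : ℝ) = 2 ^ j * g ^ (8 * j) := (h2 j).symm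
      _ ≤ 2 ^ j * g ^ (6 * j) := by
          gcongr 2 ^ j * ?_
          exact pow_le_pow_of_le_one hg0.le hg1.le (by omega)
      _ < 2 ^ (j + 1) * g ^ (6 * j) := by
          gcongr
          · norm_num
          · omega
      _ ≤ _ := by gcongr
  have hη : 1 / √(max δ₁ δ₂ * 2 ^ j) ≤ g ^ j := by
    rw [div_le_iff₀ (by positivity)]
    have : (1 / g ^ j) ≤ √(max δ₁ δ₂ * 2 ^ j) := by
      refine Real.le_sqrt_of_sq_le ?_
      rw [div_pow, one_pow, div_le_iff₀ (by positivity)]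
      calc (1 : ℝ) = 2 ^ j * g ^ (8 * j) := (h2 j).symm
        _ = g ^ (6 * j) * 2 ^ j * (g ^ j) ^ 2 := by ring
        _ ≤ _ := by gcongr
    calc (1 : ℝ) = g ^ j * (1 / g ^ j) := by field_simp
      _ ≤ _ := by gcongr
  have hb := hbad (2 ^ j) (max δ₁ δ₂) (j + 1) hQ0 hδ0 (max_le hδ₁1 hδ₂1) hK
  have hg' := hgood (2 ^ j) δ₁ δ₂ (one_le_pow₀ one_le_two) hδ₁ hδ₂ hδ₁1 hδ₂1
  refine (measure_mono ?_).trans ((measure_union_le _ _).trans ((add_le_add hb hg').trans ?_))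
  · rintro x ⟨hx, q, hq, hq', h1, h3⟩
    by_cases hxb : x ∈ dualBad f f₁ (2 ^ j) (max δ₁ δ₂)
    · exact Or.inl ⟨hx, hxb⟩
    · rw [nint_eq_abs_sub_round] at h1 h3
      refine Or.inr ⟨hx, hxb, q, round (q * x), round (q * f x), ?_, ?_, ?_, ?_⟩
      · exact_mod_cast hq
      · rw [← pow_succ']
        exact_mod_cast hq'.le
      · exact_mod_cast h1
      · exact_mod_cast h3
  · rw [← ENNReal.ofReal_add (by positivity) (by positivity)]
    refine ENNReal.ofReal_le_ofReal ?_
    have e1 : C₁ * (((j + 1 : ℕ) + 1) * (1 / √(max δ₁ δ₂ * 2 ^ j))) ≤ C₁ * ((j + 2) * g ^ j) := by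
      push_cast
      gcongr C₁ * (?_ * ?_)
      linarith
    have e2 : 0 ≤ C₁ * (2 ^ j * (δ₁ * δ₂)) := by positivity
    have e3 : 0 ≤ C₂ * ((j + 2) * g ^ j) := by positivity
    linarith

theorem exists_volume_block_le (hf : ConvexArc f f₁ α β c₁ c₂ m M) {g : ℝ} (hg0 : 0 < g)
    (hg : g ^ 8 = 1 / 2) {ψ : ℕ → ℝ} (hψpos : ∀ q, 0 < ψ q) (hψdec : Antitone ψ) :
    ∃ C : ℝ, 0 < C ∧ ∀ j : ℕ,
      volume {x | x ∈ Set.Icc α β ∧ ∃ q : ℕ, 2 ^ j ≤ q ∧ q < 2 ^ (j + 1) ∧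
        nint (q * x) * nint (q * f x) < ψ q} ≤
        ENNReal.ofReal (C * (j * 2 ^ j * ψ (2 ^ j) + (j + 1) ^ 2 * g ^ j)) := by
  obtain ⟨C, hC, hbox⟩ := hf.exists_volume_box_le hg0 hg
  have hg1 : g < 1 := by
    by_contra! h
    have := one_le_pow₀ (n := 8) h
    linarith
  refine ⟨9 * C, by positivity, fun j => ?_⟩
  set Ψ := ψ (2 ^ j) + g ^ (12 * j) with hΨ
  have hψ0 := hψpos (2 ^ j)
  have hΨ0 : 0 < Ψ := by positivity
  have hgj : 0 < g ^ j := by positivity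
  have h2 : (2 : ℝ) ^ j * g ^ (8 * j) = 1 := by
    rw [pow_mul, hg, ← mul_pow]; norm_num
  let Z : ℝ → ℝ → Set ℝ := fun δ₁ δ₂ => {x | x ∈ Set.Icc α β ∧ ∃ q : ℕ, 2 ^ j ≤ q ∧
    q < 2 ^ (j + 1) ∧ nint (q * x) < δ₁ ∧ nint (q * f x) < δ₂}
  have hZlast : volume (Z ((1 / 2) ^ (2 * j)) 1) ≤
      ENNReal.ofReal (C * (g ^ j + (j + 2) * g ^ j)) := by
    refine (hbox j _ 1 (by positivity) one_pos (pow_le_one₀ (by norm_num) (by norm_num)) le_rfl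
      ((pow_le_one₀ hg0.le hg1.le).trans (le_max_right _ _))).trans (ENNReal.ofReal_le_ofReal ?_)
    have : (2 : ℝ) ^ j * ((1 / 2) ^ (2 * j) * 1) = g ^ (8 * j) := by
      rw [← hg, ← pow_mul, mul_one]
      calc (2 : ℝ) ^ j * g ^ (8 * (2 * j)) = (2 ^ j * g ^ (8 * j)) * g ^ (8 * j) := by ring
        _ = _ := by rw [h2, one_mul]
    rw [this]
    gcongr C * (?_ + _)
    exact pow_le_pow_of_le_one hg0.le hg1.le (by omega)
  have hZ (k : ℕ) : volume (Z ((1 / 2) ^ k) (min 1 (2 ^ (k + 1) * Ψ))) ≤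
      ENNReal.ofReal (C * (2 ^ j * (2 * Ψ) + (j + 2) * g ^ j)) := by
    have hprod : (1 / 2 : ℝ) ^ k * (2 ^ (k + 1) * Ψ) = 2 * Ψ := by
      rw [pow_succ, ← mul_assoc, ← mul_assoc, ← mul_pow]; norm_num
    refine (hbox j _ _ (by positivity) (by positivity) (pow_le_one₀ (by norm_num) (by norm_num))
      (min_le_left _ _) ?_).trans (ENNReal.ofReal_le_ofReal ?_)
    · by_contra! hlt
      obtain ⟨hl1, hl2⟩ := max_lt_iff.mp hlt
      have h6 : g ^ (6 * j) ≤ 1 := pow_le_one₀ hg0.le hg1.le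
      rcases min_lt_iff.mp hl2 with h | h
      · linarith
      · have : (1 / 2 : ℝ) ^ k * (2 ^ (k + 1) * Ψ) < g ^ (6 * j) * g ^ (6 * j) := by gcongr
        rw [hprod, ← pow_add, show 6 * j + 6 * j = 12 * j by ring] at this
        linarith
    · rw [← hprod]
      gcongr
      exact min_le_right _ _
  have hcover : {x | x ∈ Set.Icc α β ∧ ∃ q : ℕ, 2 ^ j ≤ q ∧ q < 2 ^ (j + 1) ∧
      nint (q * x) * nint (q * f x) < ψ q} ⊆ Z ((1 / 2) ^ (2 * j)) 1 ∪
        ⋃ k ∈ Finset.range (2 * j), Z ((1 / 2) ^ k) (min 1 (2 ^ (k + 1) * Ψ)) := by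
    rintro x ⟨hx, q, hq, hq', h⟩
    have hb := nint_nonneg (q * f x)
    have hb1 : nint (q * f x) < 1 := (nint_le_half _).trans_lt (by norm_num)
    have ha1 : nint (q * x) < 1 := (nint_le_half _).trans_lt (by norm_num)
    rcases lt_or_ge (nint (q * x)) ((1 / 2) ^ (2 * j)) with hlt | hge
    · exact Or.inl ⟨hx, q, hq, hq', hlt, hb1⟩
    · obtain ⟨k, hk, hk1, hk2⟩ := exists_half_pow_le ha1 hge
      refine Or.inr (Set.mem_biUnion (Finset.mem_coe.mpr (Finset.mem_range.mpr hk))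
        ⟨hx, q, hq, hq', hk2, lt_min hb1 ?_⟩)
      have hlt : (1 / 2 : ℝ) ^ (k + 1) * nint (q * f x) < Ψ := by
        calc _ ≤ nint (q * x) * nint (q * f x) := by gcongr
          _ < ψ q := h
          _ ≤ ψ (2 ^ j) := hψdec hq
          _ ≤ Ψ := by rw [hΨ]; linarith [pow_pos hg0 (12 * j)]
      calc nint (q * f x) = 2 ^ (k + 1) * ((1 / 2) ^ (k + 1) * nint (q * f x)) := by
            rw [← mul_assoc, ← mul_pow]; norm_num
        _ < _ := by gcongr
  calc _ ≤ ENNReal.ofReal (C * (g ^ j + (j + 2) * g ^ j)) + ∑ k ∈ Finset.range (2 * j),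
        ENNReal.ofReal (C * (2 ^ j * (2 * Ψ) + (j + 2) * g ^ j)) :=
        (measure_mono hcover).trans <| (measure_union_le _ _).trans <| add_le_add hZlast <|
          (measure_biUnion_finset_le _ _).trans (Finset.sum_le_sum fun k _ => hZ k)
    _ = ENNReal.ofReal (C * (g ^ j + (j + 2) * g ^ j) +
        (2 * j : ℕ) * (C * (2 ^ j * (2 * Ψ) + (j + 2) * g ^ j))) := by
        rw [Finset.sum_const, Finset.card_range, nsmul_eq_mul,
          ENNReal.ofReal_add (by positivity) (by positivity),
          ENNReal.ofReal_mul (Nat.cast_nonneg (2 * j)), ENNReal.ofReal_natCast]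
    _ ≤ _ := by
        refine ENNReal.ofReal_le_ofReal ?_
        have hsmall : (2 : ℝ) ^ j * g ^ (12 * j) ≤ g ^ j := by
          calc (2 : ℝ) ^ j * g ^ (12 * j) = (2 ^ j * g ^ (8 * j)) * g ^ (4 * j) := by ring
            _ = g ^ (4 * j) := by rw [h2, one_mul]
            _ ≤ _ := pow_le_pow_of_le_one hg0.le hg1.le (by omega)
        have e : C * (g ^ j + (j + 2) * g ^ j) +
            (2 * j : ℕ) * (C * (2 ^ j * (2 * Ψ) + (j + 2) * g ^ j)) =
            C * (4 * (j * 2 ^ j * ψ (2 ^ j)) + 4 * j * (2 ^ j * g ^ (12 * j)) +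
              (2 * j ^ 2 + 5 * j + 3) * g ^ j) := by
          rw [hΨ]; push_cast; ring
        rw [e, mul_comm 9 C, mul_assoc C 9]
        have hj : (0 : ℝ) ≤ j := Nat.cast_nonneg j
        have e1 : 4 * (j : ℝ) * (2 ^ j * g ^ (12 * j)) ≤ 4 * j * g ^ j := by gcongr
        have e2 : 0 ≤ j * 2 ^ j * ψ (2 ^ j) := by positivity
        have e3 : 0 ≤ (7 * (j : ℝ) ^ 2 + 9 * j + 6) * g ^ j := by positivity
        refine mul_le_mul_of_nonneg_left ?_ hC.le
        nlinarith

end ConvexArc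

theorem summable_condensed_log {ψ : ℕ → ℝ} (hψpos : ∀ q, 0 < ψ q) (hψdec : Antitone ψ)
    (hsum : Summable fun h : ℕ => ψ h * Real.log h) :
    Summable fun j : ℕ => (j : ℝ) * 2 ^ j * ψ (2 ^ j) := by
  have hlog : 0 < Real.log 2 := Real.log_pos one_lt_two
  have hnonneg (h : ℕ) : 0 ≤ ψ h * Real.log h :=
    mul_nonneg (hψpos h).le (Real.log_natCast_nonneg h)
  have hblock (j : ℕ) : (j : ℝ) * 2 ^ j * ψ (2 ^ (j + 1)) * Real.log 2 ≤
      ∑ h ∈ Finset.Ico (2 ^ j) (2 ^ (j + 1)), ψ h * Real.log h := by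
    have hterm : ∀ h ∈ Finset.Ico (2 ^ j) (2 ^ (j + 1)),
        ψ (2 ^ (j + 1)) * (j * Real.log 2) ≤ ψ h * Real.log h := by
      intro h hh
      obtain ⟨h1, h2⟩ := Finset.mem_Ico.1 hh
      refine mul_le_mul (hψdec h2.le) ?_ (by positivity) (hψpos h).le
      rw [← Real.log_pow]
      exact Real.log_le_log (by positivity) (by exact_mod_cast h1)
    have := Finset.card_nsmul_le_sum _ _ _ hterm
    have hcard : 2 ^ (j + 1) - 2 ^ j = 2 ^ j := by rw [pow_succ]; omega
    rw [Nat.card_Ico, hcard, nsmul_eq_mul] at this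
    push_cast at this
    linarith
  have hb : Summable fun j : ℕ => (j : ℝ) * 2 ^ j * ψ (2 ^ (j + 1)) * Real.log 2 := by
    refine summable_of_sum_range_le (c := ∑' h : ℕ, ψ h * Real.log h)
      (fun j => mul_nonneg (mul_nonneg (by positivity) (hψpos _).le) hlog.le) fun n => ?_
    refine le_trans ?_ (hsum.sum_le_tsum (Finset.range (2 ^ n)) fun h _ => hnonneg h)
    induction n with
    | zero => simp
    | succ n ih =>
      have hsplit := Finset.sum_Ico_consecutive (fun h : ℕ => ψ h * Real.log h)
        (Nat.zero_le (2 ^ n)) (Nat.pow_le_pow_right two_pos n.le_succ)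
      rw [← Finset.range_eq_Ico, ← Finset.range_eq_Ico] at hsplit
      rw [Finset.sum_range_succ, ← hsplit]
      exact add_le_add ih (hblock n)
  refine (summable_nat_add_iff 2).1 (Summable.of_nonneg_of_le
    (fun j => mul_nonneg (by positivity) (hψpos _).le) (fun j => ?_)
    (((summable_nat_add_iff 1).2 hb).mul_left (4 / Real.log 2)))
  have hψ0 := hψpos (2 ^ (j + 2))
  have e : 4 / Real.log 2 * (((j + 1 : ℕ) : ℝ) * 2 ^ (j + 1) * ψ (2 ^ (j + 1 + 1)) * Real.log 2) =
      (2 * j + 2) * 2 ^ (j + 2) * ψ (2 ^ (j + 2)) := by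
    rw [show j + 1 + 1 = j + 2 from rfl]
    push_cast
    field_simp
    ring
  rw [e]
  have : (0 : ℝ) ≤ j := Nat.cast_nonneg j
  push_cast
  gcongr
  linarith

theorem summable_sq_mul_geometric {g : ℝ} (hg0 : 0 ≤ g) (hg1 : g < 1) :
    Summable fun j : ℕ => ((j : ℝ) + 1) ^ 2 * g ^ j := by
  have h (k : ℕ) : Summable fun j : ℕ => (j : ℝ) ^ k * g ^ j :=
    summable_pow_mul_geometric_of_norm_lt_one k (by rwa [Real.norm_of_nonneg hg0])
  refine (((h 2).add ((h 1).mul_left 2)).add (h 0)).congr fun j => ?_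
  ring

namespace ConvexArc

variable {f f₁ : ℝ → ℝ} {α β c₁ c₂ m M : ℝ}

theorem volume_infinite_eq_zero (hf : ConvexArc f f₁ α β c₁ c₂ m M) {ψ : ℕ → ℝ}
    (hψpos : ∀ q, 0 < ψ q) (hψdec : Antitone ψ)
    (hsum : Summable fun h : ℕ => ψ h * Real.log h) :
    volume {x : ℝ | x ∈ Set.Icc α β ∧
      {q : ℕ | 0 < q ∧ nint (q * x) * nint (q * f x) < ψ q}.Infinite} = 0 := by
  set g : ℝ := (1 / 2) ^ (1 / 8 : ℝ) with hgdef
  have hg0 : 0 < g := by positivity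
  have hg : g ^ 8 = 1 / 2 := by
    rw [hgdef, ← Real.rpow_natCast, ← Real.rpow_mul (by norm_num)]
    norm_num
  have hg1 : g < 1 := Real.rpow_lt_one (by norm_num) (by norm_num) (by norm_num)
  obtain ⟨C, hC, hvol⟩ := hf.exists_volume_block_le hg0 hg hψpos hψdec
  have hs : Summable fun j : ℕ =>
      C * ((j : ℝ) * 2 ^ j * ψ (2 ^ j) + ((j : ℝ) + 1) ^ 2 * g ^ j) :=
    ((summable_condensed_log hψpos hψdec hsum).add
      (summable_sq_mul_geometric hg0.le hg1)).mul_left C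
  have hlim := measure_setOfPred_frequently_eq_zero (μ := volume)
    (ne_top_of_le_ne_top hs.tsum_ofReal_ne_top (ENNReal.tsum_le_tsum hvol))
  refine measure_mono_null ?_ hlim
  rintro x ⟨hx, hinf⟩
  refine frequently_atTop.2 fun J => ?_
  obtain ⟨q, ⟨hq0, hq⟩, hJ⟩ := hinf.exists_gt (2 ^ J)
  exact ⟨Nat.log 2 q, Nat.le_log_of_pow_le one_lt_two hJ.le, hx, q,
    Nat.pow_log_le_self 2 hq0.ne', Nat.lt_pow_succ_log_self one_lt_two q, hq⟩

end ConvexArc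

section Curve

variable {I : Set ℝ} {f : ℝ → ℝ}

theorem ContDiffOn.hasDerivAt_deriv (hI : IsOpen I) (hf : ContDiffOn ℝ 3 f I) :
    ∀ x ∈ I, HasDerivAt f (deriv f x) x ∧ HasDerivAt (deriv f) (iteratedDeriv 2 f x) x ∧
      ContinuousAt (iteratedDeriv 2 f) x := by
  have h1 : ContDiffOn ℝ 2 (deriv f) I := hf.deriv_of_isOpen hI (by norm_num)
  have h2 : ContDiffOn ℝ 1 (deriv (deriv f)) I := h1.deriv_of_isOpen hI (by norm_num)
  have e : iteratedDeriv 2 f = deriv (deriv f) := by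
    rw [iteratedDeriv_succ, iteratedDeriv_one]
  intro x hx
  have hxI := hI.mem_nhds hx
  rw [e]
  exact ⟨((hf.contDiffAt hxI).differentiableAt (by norm_num)).hasDerivAt,
    ((h1.contDiffAt hxI).differentiableAt (by norm_num)).hasDerivAt,
    (h2.contDiffAt hxI).continuousAt⟩

theorem volume_infinite_Icc_eq_zero (hI : IsOpen I) (hf : ContDiffOn ℝ 3 f I) {c₁ c₂ : ℝ}
    (hc₂ : 0 < c₂) (hderiv : ∀ x ∈ I, c₂ < deriv f x ∧ deriv f x < c₁)
    (hderiv2 : ∀ x ∈ I, iteratedDeriv 2 f x ≠ 0) {ψ : ℕ → ℝ} (hψpos : ∀ q, 0 < ψ q)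
    (hψdec : Antitone ψ) (hsum : Summable fun h : ℕ => ψ h * Real.log h) {α β : ℝ}
    (hαβ : α ≤ β) (hsub : Set.Icc α β ⊆ I) :
    volume {x : ℝ | x ∈ Set.Icc α β ∧
      {q : ℕ | 0 < q ∧ nint (q * x) * nint (q * f x) < ψ q}.Infinite} = 0 := by
  have hd := hf.hasDerivAt_deriv hI
  have hcont : ContinuousOn (iteratedDeriv 2 f) (Set.Icc α β) :=
    fun x hx => (hd x (hsub hx)).2.2.continuousWithinAt
  have hne : (Set.Icc α β).Nonempty := Set.nonempty_Icc.2 hαβ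
  obtain ⟨u, hu, hmin⟩ := isCompact_Icc.exists_isMinOn hne hcont
  obtain ⟨v, hv, hmax⟩ := isCompact_Icc.exists_isMaxOn hne hcont
  have hf₁ : ∀ x ∈ Set.Icc α β, c₂ ≤ |deriv f x| ∧ |deriv f x| ≤ c₁ := by
    intro x hx
    have := hderiv x (hsub hx)
    rw [abs_of_pos (hc₂.trans this.1)]
    exact ⟨this.1.le, this.2.le⟩
  have hsign : 0 < iteratedDeriv 2 f u ∨ iteratedDeriv 2 f v < 0 := by
    by_contra! h
    obtain ⟨w, hw, h0⟩ := isPreconnected_Icc.intermediate_value hu hv hcont ⟨h.1, h.2⟩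
    exact hderiv2 w (hsub hw) h0
  rcases hsign with h0 | h0
  · exact (ConvexArc.of_hasDerivAt hαβ hc₂ h0 (fun x hx => (hd x (hsub hx)).1)
      (fun x hx => (hd x (hsub hx)).2.1) hf₁
      fun x hx => ⟨hmin hx, hmax hx⟩).volume_infinite_eq_zero hψpos hψdec hsum
  · have := (ConvexArc.of_hasDerivAt (f := fun x => -f x) (f₁ := fun x => -deriv f x)
      (f₂ := fun x => -iteratedDeriv 2 f x) hαβ hc₂ (neg_pos.2 h0)
      (fun x hx => (hd x (hsub hx)).1.neg) (fun x hx => (hd x (hsub hx)).2.1.neg)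
      (fun x hx => by rw [abs_neg]; exact hf₁ x hx)
      fun x hx => ⟨neg_le_neg (hmax hx), neg_le_neg (hmin hx)⟩).volume_infinite_eq_zero
      hψpos hψdec hsum
    simpa only [mul_neg, nint_neg] using this

theorem measure_eq_zero_of_forall_Icc (hI : IsOpen I) {μ : Measure ℝ} {p : ℝ → Prop}
    (h : ∀ α β : ℝ, α ≤ β → Set.Icc α β ⊆ I → μ {x | x ∈ Set.Icc α β ∧ p x} = 0) :
    μ {x | x ∈ I ∧ p x} = 0 := by
  refine measure_mono_null (t := ⋃ r : ℚ × ℚ, ⋃ _ : (r.1 : ℝ) ≤ r.2 ∧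
    Set.Icc (r.1 : ℝ) r.2 ⊆ I, {x | x ∈ Set.Icc (r.1 : ℝ) r.2 ∧ p x}) ?_
    (measure_iUnion_null fun r => measure_iUnion_null fun hr => h _ _ hr.1 hr.2)
  rintro x ⟨hx, hp⟩
  obtain ⟨ε, hε, hball⟩ := Metric.isOpen_iff.1 hI x hx
  obtain ⟨a, ha, ha'⟩ := exists_rat_btwn (sub_lt_self x hε)
  obtain ⟨b, hb, hb'⟩ := exists_rat_btwn (lt_add_of_pos_right x hε)
  simp only [Set.mem_iUnion]
  refine ⟨(a, b), ⟨(ha'.trans hb).le, fun y hy => hball ?_⟩, ⟨ha'.le, hb.le⟩, hp⟩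
  rw [Real.ball_eq_Ioo]
  exact ⟨ha.trans_le hy.1, hy.2.trans_lt hb'⟩

theorem hausdorffMeasure_graph_eq_zero {s : Set ℝ} {K : NNReal} (hf : LipschitzOnWith K f s)
    (hs : volume s = 0) :
    μH[(1 : ℝ)] {p : EuclideanSpace ℝ (Fin 2) | p 0 ∈ s ∧ p 1 = f (p 0)} = 0 := by
  have hlip : LipschitzOnWith (1 + K) (fun x => (!₂[x, f x] : EuclideanSpace ℝ (Fin 2))) s := by
    refine LipschitzOnWith.of_dist_le_mul fun x hx y hy => ?_
    have h := hf.dist_le_mul x hx y hy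
    rw [EuclideanSpace.dist_eq, Fin.sum_univ_two]
    refine Real.sqrt_le_iff.2 ⟨by positivity, ?_⟩
    have h0 : 0 ≤ (K : ℝ) * dist x y := by positivity
    have h1 : dist (f x) (f y) ^ 2 ≤ (K * dist x y) ^ 2 := by gcongr
    simp only [Matrix.cons_val_zero, Matrix.cons_val_one]
    push_cast
    nlinarith [mul_nonneg h0 (dist_nonneg (x := x) (y := y))]
  have himage : {p : EuclideanSpace ℝ (Fin 2) | p 0 ∈ s ∧ p 1 = f (p 0)} ⊆
      (fun x => (!₂[x, f x] : EuclideanSpace ℝ (Fin 2))) '' s := by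
    rintro p ⟨hp, hp1⟩
    refine ⟨p 0, hp, ?_⟩
    ext i
    fin_cases i
    · rfl
    · exact hp1.symm
  refine measure_mono_null himage (nonpos_iff_eq_zero.1 ?_)
  refine (hlip.hausdorffMeasure_image_le zero_le_one).trans ?_
  rw [hausdorffMeasure_real, hs, mul_zero]

end Curve

/-- If `Σ_h ψ(h) log h < ∞` then `ℋ¹(C_f ∩ S₂*(ψ)) = 0`; in particular the set of
`x ∈ I` with `(x, f(x)) ∈ S₂*(ψ)` has Lebesgue measure zero. -/
theorem curve_inter_S2star_measure_zero
    (I : Set ℝ) (hIopen : IsOpen I) (hIconn : I.OrdConnected)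
    (f : ℝ → ℝ) (hf : ContDiffOn ℝ 3 f I)
    (c₁ c₂ : ℝ) (hc₂pos : 0 < c₂) (hc₂₁ : c₂ < c₁)
    (hderiv : ∀ x ∈ I, c₂ < deriv f x ∧ deriv f x < c₁)
    (hderiv2 : ∀ x ∈ I, iteratedDeriv 2 f x ≠ 0)
    (ψ : ℕ → ℝ) (hψpos : ∀ q, 0 < ψ q) (hψdec : Antitone ψ)
    (hsum : Summable (fun h : ℕ => ψ h * Real.log h)) :
    μH[(1 : ℝ)] ({ p : EuclideanSpace ℝ (Fin 2) | p 0 ∈ I ∧ p 1 = f (p 0) } ∩ S2star ψ) = 0 ∧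
    volume {x : ℝ | x ∈ I ∧
      {q : ℕ | 0 < q ∧ nint (q * x) * nint (q * f x) < ψ q}.Infinite} = 0 := by
  have hnull : volume {x : ℝ | x ∈ I ∧
      {q : ℕ | 0 < q ∧ nint (q * x) * nint (q * f x) < ψ q}.Infinite} = 0 :=
    measure_eq_zero_of_forall_Icc hIopen fun α β hαβ hsub =>
      volume_infinite_Icc_eq_zero hIopen hf hc₂pos hderiv hderiv2 hψpos hψdec hsum hαβ hsub
  refine ⟨?_, hnull⟩
  have hlip : LipschitzOnWith c₁.toNNReal f I := by
    refine hIconn.convex.lipschitzOnWith_of_nnnorm_deriv_le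
      (fun x hx => (hf.hasDerivAt_deriv hIopen x hx).1.differentiableAt) fun x hx => ?_
    have := hderiv x hx
    rw [← NNReal.coe_le_coe, coe_nnnorm, Real.norm_of_nonneg (hc₂pos.trans this.1).le,
      Real.coe_toNNReal _ (hc₂pos.trans hc₂₁).le]
    exact this.2.le
  refine measure_mono_null ?_ (hausdorffMeasure_graph_eq_zero (hlip.mono fun x hx => hx.1) hnull)
  rintro p ⟨⟨hp, hp1⟩, hS⟩
  refine ⟨⟨hp, ?_⟩, hp1⟩
  rw [← hp1]
  exact hS
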